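/- Let h be a gauge function and let w be a non-negative function in L^1(|dζ|) on the unit circle 𝕋 such that ∫_E log w |dζ| = -∞ for every h-Carleson set E ⊂ 𝕋 of positive arclength measure. Set R = log^+(1/w). Let N be a (large) positive integer, let I be an arc of 𝕋, and let A_N = {ζ ∈ 𝕋 : R(ζ) ≤ N}; assume |A_N ∩ I| > 0. Then there exist a numerical constant C_0 > 0 (independent of N, I and w) and a bounded real-valued measurable function f_{N,I} supported on I such that: (i) f_{N,I} ≤ R a.e. on 𝕋; (ii) ∫_Δ f_{N,I} |dζ| ≤ h(|Δ|) for every arc Δ ⊂ 𝕋; (iii) ∫_I f_{N,I} |dζ| = 0; and (iv) f_{N,I}(ζ) ≤ -C_0 h(|I|)/|I| for ζ ∈ A_N ∩ I. -/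

import Mathlib

open MeasureTheory Set Filter Topology

noncomputable section

local instance : Fact (0 < 2 * Real.pi) := ⟨by positivity⟩

/-- The unit circle `𝕋`, modelled as `ℝ / 2πℤ` with its arclength (Haar) measure,
of total mass `2π`. -/
abbrev UnitCircle := AddCircle (2 * Real.pi)

/-- A gauge function: continuous, increasing on `[0,∞)`, vanishing at `0`, with
`(R1)` `h x / x` decreasing and `(R2)` `h x / x → ∞` as `x → 0+`. -/
structure IsGauge (h : ℝ → ℝ) : Prop where
  continuousOn : ContinuousOn h (Set.Ici 0)
  mono : MonotoneOn h (Set.Ici 0)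
  zero : h 0 = 0
  r1 : ∀ ⦃x y : ℝ⦄, 0 < x → x ≤ y → h y / y ≤ h x / x
  r2 : Filter.Tendsto (fun x => h x / x) (nhdsWithin 0 (Set.Ioi 0)) Filter.atTop

/-- An arc of the circle: a connected subset (the empty set is allowed as a
degenerate arc). -/
def IsArc (I : Set UnitCircle) : Prop := IsPreconnected I

/-- An `h`-Carleson set: a closed subset of the circle whose complement is a countable
disjoint union of open arcs `I_k` (namely its maximal complementary arcs) with
`Σ_k h(|I_k|) < ∞`. -/
def IsHCarleson (h : ℝ → ℝ) (E : Set UnitCircle) : Prop :=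
  IsClosed E ∧ ∃ I : ℕ → Set UnitCircle,
    (∀ k, IsOpen (I k) ∧ IsPreconnected (I k)) ∧
    (∀ k l, k ≠ l → Disjoint (I k) (I l)) ∧
    (⋃ k, I k) = Eᶜ ∧
    (∑' k, ENNReal.ofReal (h (volume (I k)).toReal)) < ⊤

/-- `nlog t = log⁺(1/t)`, valued in `[0,∞]`, with `nlog 0 = ∞`. For `w ≥ 0` this is
the function `R = log⁺(1/w)` of Khrushchev; moreover, since the positive part of
`log w` is automatically integrable for `w ∈ L¹`, the divergence condition
`∫_E log w |dζ| = -∞` is faithfully expressed as `∫⁻_E nlog (w ζ) |dζ| = ∞`. -/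
def nlog (t : ℝ) : ENNReal := if t = 0 then ⊤ else ENNReal.ofReal (Real.log t⁻¹)

/-- The `i`-th half-open interval of length `L / 2 ^ n` to the right of `a`. -/
def dyadic (a L : ℝ) (n i : ℕ) : Set ℝ :=
  Ioc (a + i * (L / 2 ^ n)) (a + (i + 1) * (L / 2 ^ n))

lemma measurableSet_dyadic (a L : ℝ) (n i : ℕ) : MeasurableSet (dyadic a L n i) :=
  measurableSet_Ioc

lemma volume_dyadic (a L : ℝ) (n i : ℕ) :
    volume (dyadic a L n i) = ENNReal.ofReal (L / 2 ^ n) := by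
  rw [dyadic, Real.volume_Ioc]
  congr 1
  ring

lemma dyadic_zero (a L : ℝ) : dyadic a L 0 0 = Ioc a (a + L) := by
  simp [dyadic]

lemma dyadic_split {a L : ℝ} (hL : 0 < L) (n i : ℕ) :
    dyadic a L n i = dyadic a L (n + 1) (2 * i) ∪ dyadic a L (n + 1) (2 * i + 1) := by
  have hl : 0 < L / 2 ^ (n + 1) := by positivity
  have h2 : L / 2 ^ n = 2 * (L / 2 ^ (n + 1)) := by
    rw [pow_succ]; field_simp
  unfold dyadic
  push_cast
  rw [h2, Ioc_union_Ioc_eq_Ioc (by nlinarith) (by nlinarith)]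
  congr 1 <;> ring

lemma disjoint_dyadic {a L : ℝ} (hL : 0 < L) (n : ℕ) {i j : ℕ} (hij : i ≠ j) :
    Disjoint (dyadic a L n i) (dyadic a L n j) := by
  have hl : 0 < L / 2 ^ n := by positivity
  wlog hlt : i < j generalizing i j
  · exact (this hij.symm (by omega)).symm
  rw [Set.disjoint_left]
  rintro x ⟨_, hx⟩ ⟨hx', _⟩
  have : (i : ℝ) + 1 ≤ j := by exact_mod_cast hlt
  nlinarith

lemma dyadic_subset_half {a L : ℝ} (hL : 0 < L) (n j : ℕ) :
    dyadic a L (n + 1) j ⊆ dyadic a L n (j / 2) := by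
  rw [dyadic_split hL n (j / 2)]
  rcases Nat.even_or_odd' j with ⟨k, rfl | rfl⟩
  · rw [show 2 * k / 2 = k by omega]; exact subset_union_left
  · rw [show (2 * k + 1) / 2 = k by omega]; exact subset_union_right

lemma exists_dyadic_superset {a L : ℝ} (hL : 0 < L) {n m : ℕ} (hnm : n ≤ m) (j : ℕ) :
    ∃ i, dyadic a L m j ⊆ dyadic a L n i := by
  induction m, hnm using Nat.le_induction generalizing j with
  | base => exact ⟨j, subset_rfl⟩
  | succ m _ ih =>
    obtain ⟨i, hi⟩ := ih (j / 2)
    exact ⟨i, (dyadic_subset_half hL m j).trans hi⟩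

/-- A bounded minorant of `r` whose mass on each dyadic interval of generation `n` is
at most `H n`. -/
structure Admissible (a L : ℝ) (H : ℕ → ENNReal) (r g : ℝ → ENNReal) : Prop where
  measurable : Measurable g
  le : ∀ x, g x ≤ r x
  bounded : ∃ M : NNReal, ∀ x, g x ≤ M
  mass_le : ∀ n i, ∫⁻ x in dyadic a L n i, g x ≤ H n

lemma Admissible.zero (a L : ℝ) (H : ℕ → ENNReal) (r : ℝ → ENNReal) :
    Admissible a L H r 0 :=
  ⟨measurable_const, fun _ => zero_le, ⟨0, by simp⟩, by simp⟩

/-- The largest mass an admissible function can place on a dyadic interval. -/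
def dyadicCapacity (a L : ℝ) (H : ℕ → ENNReal) (r : ℝ → ENNReal) (n i : ℕ) : ENNReal :=
  ⨆ (g : ℝ → ENNReal) (_ : Admissible a L H r g), ∫⁻ x in dyadic a L n i, g x

lemma Admissible.le_capacity {a L : ℝ} {H : ℕ → ENNReal} {r g : ℝ → ENNReal}
    (hg : Admissible a L H r g) (n i : ℕ) :
    ∫⁻ x in dyadic a L n i, g x ≤ dyadicCapacity a L H r n i :=
  le_iSup₂ (f := fun g (_ : Admissible a L H r g) => ∫⁻ x in dyadic a L n i, g x) g hg

/-- Two admissible functions on the halves of a dyadic interval can be glued, after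
multiplication by a constant, to an admissible function on the interval. -/
lemma Admissible.glue {a L : ℝ} (hL : 0 < L) {H : ℕ → ENNReal} (hH : Antitone H)
    (hfin : ∀ n, H n ≠ ⊤) {r g₁ g₂ : ℝ → ENNReal}
    (h₁ : Admissible a L H r g₁) (h₂ : Admissible a L H r g₂) (n i : ℕ) :
    min (H n) ((∫⁻ x in dyadic a L (n + 1) (2 * i), g₁ x)
      + ∫⁻ x in dyadic a L (n + 1) (2 * i + 1), g₂ x) ≤ dyadicCapacity a L H r n i := by
  set D₁ := dyadic a L (n + 1) (2 * i) with hD₁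
  set D₂ := dyadic a L (n + 1) (2 * i + 1) with hD₂
  set S := (∫⁻ x in D₁, g₁ x) + ∫⁻ x in D₂, g₂ x
  have hdisj : Disjoint D₁ D₂ := disjoint_dyadic hL _ (by omega)
  have mD₁ : MeasurableSet D₁ := measurableSet_dyadic _ _ _ _
  have mD₂ : MeasurableSet D₂ := measurableSet_dyadic _ _ _ _
  have hStop : S ≠ ⊤ := ENNReal.add_ne_top.2
    ⟨((h₁.mass_le _ _).trans_lt (hfin _).lt_top).ne, ((h₂.mass_le _ _).trans_lt (hfin _).lt_top).ne⟩
  obtain ⟨t, ht1, htS⟩ : ∃ t : ENNReal, t ≤ 1 ∧ t * S = min (H n) S := by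
    rcases le_total S (H n) with hle | hle
    · exact ⟨1, le_rfl, by rw [one_mul, min_eq_right hle]⟩
    · rcases eq_or_ne S 0 with h0 | h0
      · exact ⟨1, le_rfl, by simp [h0]⟩
      · refine ⟨H n / S, ENNReal.div_le_of_le_mul (by simpa using hle), ?_⟩
        rw [min_eq_left hle, ENNReal.div_mul_cancel h0 hStop]
  set g : ℝ → ENNReal := fun x => t * (D₁.indicator g₁ x + D₂.indicator g₂ x) with hg
  have mg₁ := h₁.measurable.indicator mD₁
  have mg₂ := h₂.measurable.indicator mD₂
  have mg : Measurable g := (mg₁.add mg₂).const_mul _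
  have hle_sum : ∀ x, g x ≤ D₁.indicator g₁ x + D₂.indicator g₂ x := fun x =>
    mul_le_of_le_one_left' ht1
  have hpt : ∀ x, g x ≤ max (g₁ x) (g₂ x) := by
    intro x
    refine (hle_sum x).trans ?_
    by_cases hx : x ∈ D₁
    · have : x ∉ D₂ := Set.disjoint_left.1 hdisj hx
      simp [hx, this]
    · by_cases hx2 : x ∈ D₂ <;> simp [hx, hx2]
  have htot : ∫⁻ x, g x = min (H n) S := by
    rw [← htS, hg, lintegral_const_mul t
      (f := fun x => D₁.indicator g₁ x + D₂.indicator g₂ x) (mg₁.add mg₂),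
      lintegral_add_left mg₁,
      lintegral_indicator mD₁, lintegral_indicator mD₂]
  have hadm : Admissible a L H r g := by
    refine ⟨mg, fun x => (hpt x).trans (max_le (h₁.le x) (h₂.le x)), ?_, fun m j => ?_⟩
    · obtain ⟨M₁, hM₁⟩ := h₁.bounded
      obtain ⟨M₂, hM₂⟩ := h₂.bounded
      refine ⟨max M₁ M₂, fun x => (hpt x).trans ?_⟩
      push_cast
      exact max_le_max (hM₁ x) (hM₂ x)
    · rcases le_or_gt m n with hmn | hmn
      · calc ∫⁻ x in dyadic a L m j, g x ≤ ∫⁻ x, g x := setLIntegral_le_lintegral _ _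
          _ ≤ H n := htot ▸ min_le_left _ _
          _ ≤ H m := hH hmn
      · obtain ⟨k, hk⟩ := exists_dyadic_superset (a := a) hL (show n + 1 ≤ m from hmn) j
        rcases eq_or_ne k (2 * i) with hk1 | hk1
        · refine le_trans (setLIntegral_mono h₁.measurable fun x hx => ?_) (h₁.mass_le m j)
          have hx1 : x ∈ D₁ := by rw [hD₁, ← hk1]; exact hk hx
          have hx2 : x ∉ D₂ := Set.disjoint_left.1 hdisj hx1
          simpa [hx1, hx2] using hle_sum x
        · refine le_trans (setLIntegral_mono h₂.measurable fun x hx => ?_) (h₂.mass_le m j)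
          have hx1 : x ∉ D₁ := Set.disjoint_left.1 (disjoint_dyadic hL _ hk1) (hk hx)
          refine (hle_sum x).trans ?_
          by_cases hx2 : x ∈ D₂ <;> simp [hx1, hx2]
  rw [← htot]
  refine le_trans (le_of_eq ?_) (hadm.le_capacity n i)
  rw [← lintegral_indicator (measurableSet_dyadic _ _ _ _)]
  refine lintegral_congr fun x => ?_
  by_cases hx : x ∈ dyadic a L n i
  · simp [hx]
  · rw [dyadic_split hL] at hx
    have hx' : x ∉ D₁ ∧ x ∉ D₂ := by simpa [not_or] using hx
    have : x ∉ dyadic a L n i := by rw [dyadic_split hL]; exact hx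
    simp [hg, hx'.1, hx'.2, this]

lemma capacity_add_le {a L : ℝ} (hL : 0 < L) {H : ℕ → ENNReal} (hH : Antitone H)
    (hfin : ∀ n, H n ≠ ⊤) {r : ℝ → ENNReal} {n i : ℕ}
    (hlt : dyadicCapacity a L H r n i < H n) :
    dyadicCapacity a L H r (n + 1) (2 * i) + dyadicCapacity a L H r (n + 1) (2 * i + 1)
      ≤ dyadicCapacity a L H r n i := by
  refine ENNReal.biSup_add_biSup_le' ⟨0, Admissible.zero _ _ _ _⟩ ⟨0, Admissible.zero _ _ _ _⟩
    fun g₁ h₁ g₂ h₂ => ?_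
  rcases min_le_iff.1 (h₁.glue hL hH hfin h₂ n i) with h | h
  · exact absurd h hlt.not_ge
  · exact h

/-- The indices of the two halves of the dyadic intervals indexed by `s`. -/
def halves (s : Finset ℕ) : Finset ℕ := s.image (2 * ·) ∪ s.image (2 * · + 1)

lemma mem_halves {s : Finset ℕ} {j : ℕ} : j ∈ halves s ↔ j / 2 ∈ s := by
  simp only [halves, Finset.mem_union, Finset.mem_image]
  constructor
  · rintro (⟨i, hi, rfl⟩ | ⟨i, hi, rfl⟩)
    · rwa [show 2 * i / 2 = i by omega]
    · rwa [show (2 * i + 1) / 2 = i by omega]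
  · intro h
    rcases Nat.even_or_odd' j with ⟨k, hk | hk⟩
    · exact Or.inl ⟨j / 2, h, by omega⟩
    · exact Or.inr ⟨j / 2, h, by omega⟩

lemma sum_halves (s : Finset ℕ) (F : ℕ → ENNReal) :
    ∑ j ∈ halves s, F j = ∑ i ∈ s, (F (2 * i) + F (2 * i + 1)) := by
  rw [halves, Finset.sum_union, Finset.sum_image, Finset.sum_image, Finset.sum_add_distrib]
  · intro x _ y _ h; simpa using h
  · intro x _ y _ h; simpa using h
  · rw [Finset.disjoint_left]
    simp only [Finset.mem_image, not_exists, not_and, forall_exists_index, and_imp]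
    rintro _ i _ rfl j _ h
    omega

open Classical in
/-- The indices of generation `n` of a stopping-time selection which continues as long as
`V n i < H n`. -/
def live (V : ℕ → ℕ → ENNReal) (H : ℕ → ENNReal) : ℕ → Finset ℕ
  | 0 => {0}
  | n + 1 => {j ∈ halves (live V H n) | V (n + 1) j < H (n + 1)}

open Classical in
/-- The indices of generation `n + 1` at which the selection `live` stops. -/
def stopped (V : ℕ → ℕ → ENNReal) (H : ℕ → ENNReal) (n : ℕ) : Finset ℕ :=
  {j ∈ halves (live V H n) | ¬ V (n + 1) j < H (n + 1)}

lemma lt_of_mem_live {V : ℕ → ℕ → ENNReal} {H : ℕ → ENNReal} (h0 : V 0 0 < H 0)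
    {n i : ℕ} (hi : i ∈ live V H n) : V n i < H n := by
  cases n with
  | zero => rw [live, Finset.mem_singleton] at hi; rwa [hi]
  | succ n => rw [live, Finset.mem_filter] at hi; exact hi.2

lemma sum_live_add_sum_stopped_le {V : ℕ → ℕ → ENNReal} {H : ℕ → ENNReal} (h0 : V 0 0 < H 0)
    (hV : ∀ n i, V n i < H n → V (n + 1) (2 * i) + V (n + 1) (2 * i + 1) ≤ V n i) (n : ℕ) :
    ∑ i ∈ live V H n, V n i + ∑ m ∈ Finset.range n, ∑ _i ∈ stopped V H m, H (m + 1) ≤ V 0 0 := by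
  classical
  induction n with
  | zero => simp [live]
  | succ n ih =>
    refine le_trans ?_ ih
    rw [Finset.sum_range_succ, add_comm (∑ m ∈ Finset.range n, _), ← add_assoc]
    gcongr ?_ + _
    calc ∑ i ∈ live V H (n + 1), V (n + 1) i + ∑ _i ∈ stopped V H n, H (n + 1)
        ≤ ∑ i ∈ live V H (n + 1), V (n + 1) i + ∑ i ∈ stopped V H n, V (n + 1) i := by
          gcongr with i hi
          rw [stopped, Finset.mem_filter] at hi
          exact not_lt.1 hi.2
      _ = ∑ j ∈ halves (live V H n), V (n + 1) j := by
          rw [live, stopped, Finset.sum_filter_add_sum_filter_not]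
      _ = ∑ i ∈ live V H n, (V (n + 1) (2 * i) + V (n + 1) (2 * i + 1)) := sum_halves _ _
      _ ≤ ∑ i ∈ live V H n, V n i :=
          Finset.sum_le_sum fun i hi => hV n i (lt_of_mem_live h0 hi)

/-- The union of the live dyadic intervals of generation `n`. -/
def liveSet (a L : ℝ) (V : ℕ → ℕ → ENNReal) (H : ℕ → ENNReal) (n : ℕ) : Set ℝ :=
  ⋃ i ∈ live V H n, dyadic a L n i

lemma dyadic_subset_liveSet {a L : ℝ} (hL : 0 < L) {V : ℕ → ℕ → ENNReal} {H : ℕ → ENNReal}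
    {n j : ℕ} (hj : j ∈ halves (live V H n)) :
    dyadic a L (n + 1) j ⊆ liveSet a L V H n :=
  (dyadic_subset_half hL n j).trans (subset_biUnion_of_mem (u := fun i => dyadic a L n i)
    (mem_halves.1 hj))

lemma antitone_liveSet {a L : ℝ} (hL : 0 < L) (V : ℕ → ℕ → ENNReal) (H : ℕ → ENNReal) :
    Antitone (liveSet a L V H) := by
  refine antitone_nat_of_succ_le fun n => ?_
  refine iUnion₂_subset fun i hi => dyadic_subset_liveSet hL ?_
  rw [live] at hi
  exact (Finset.mem_filter.1 hi).1

lemma disjoint_dyadic_stopped {a L : ℝ} (hL : 0 < L) {V : ℕ → ℕ → ENNReal} {H : ℕ → ENNReal}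
    {m n i j : ℕ} (hi : i ∈ stopped V H m) (hj : j ∈ stopped V H n) (hne : (m, i) ≠ (n, j)) :
    Disjoint (dyadic a L (m + 1) i) (dyadic a L (n + 1) j) := by
  wlog hmn : m ≤ n generalizing m n i j
  · exact (this hj hi hne.symm (by omega)).symm
  rcases hmn.eq_or_lt with rfl | hlt
  · exact disjoint_dyadic hL _ (by simpa using hne)
  · have hsub : dyadic a L (n + 1) j ⊆ liveSet a L V H (m + 1) :=
      (dyadic_subset_liveSet hL (Finset.mem_filter.1 hj).1).trans (antitone_liveSet hL V H hlt)
    refine Disjoint.mono_right hsub ?_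
    rw [liveSet, disjoint_iUnion₂_right]
    intro k hk
    refine disjoint_dyadic hL _ ?_
    rintro rfl
    rw [live] at hk
    exact (Finset.mem_filter.1 hi).2 (Finset.mem_filter.1 hk).2

lemma diff_stopped_subset_liveSet {a L : ℝ} (hL : 0 < L) (V : ℕ → ℕ → ENNReal)
    (H : ℕ → ENNReal) (n : ℕ) :
    Ioc a (a + L) \ ⋃ (m) (i ∈ stopped V H m), dyadic a L (m + 1) i ⊆ liveSet a L V H n := by
  induction n with
  | zero => simp [liveSet, live, dyadic_zero]
  | succ n ih =>
    intro x hx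
    obtain ⟨i, hi, hxi⟩ := mem_iUnion₂.1 (ih hx)
    obtain ⟨j, hj, hxj⟩ : ∃ j ∈ halves (live V H n), x ∈ dyadic a L (n + 1) j := by
      rw [dyadic_split hL] at hxi
      rcases hxi with h | h
      · exact ⟨_, mem_halves.2 (by rwa [show 2 * i / 2 = i by omega]), h⟩
      · exact ⟨_, mem_halves.2 (by rwa [show (2 * i + 1) / 2 = i by omega]), h⟩
    by_cases hs : V (n + 1) j < H (n + 1)
    · exact mem_iUnion₂.2 ⟨j, by rw [live]; exact Finset.mem_filter.2 ⟨hj, hs⟩, hxj⟩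
    · refine absurd (mem_iUnion.2 ⟨n, mem_iUnion₂.2 ⟨j, ?_, hxj⟩⟩) hx.2
      exact Finset.mem_filter.2 ⟨hj, hs⟩

/-- On short dyadic intervals the truncations of `r` are admissible. -/
lemma setLIntegral_min_le_capacity {a L : ℝ} {H : ℕ → ENNReal} (hH : Antitone H)
    {r : ℝ → ENNReal} (hr : Measurable r) (M : NNReal) {n : ℕ}
    (hn : ∀ m ≥ n, M * ENNReal.ofReal (L / 2 ^ m) ≤ H m) (i : ℕ) :
    ∫⁻ x in dyadic a L n i, min (r x) M ≤ dyadicCapacity a L H r n i := by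
  set D := dyadic a L n i with hD
  have mD : MeasurableSet D := measurableSet_dyadic _ _ _ _
  have bound : ∀ m j, ∫⁻ x in dyadic a L m j, min (r x) M ≤ M * ENNReal.ofReal (L / 2 ^ m) := by
    intro m j
    rw [← volume_dyadic a L m j, ← setLIntegral_const]
    exact lintegral_mono fun x => min_le_right _ _
  have hle : ∀ x, D.indicator (fun x => min (r x) (M : ENNReal)) x ≤ min (r x) M :=
    fun x => indicator_le_self _ _ x
  have hadm : Admissible a L H r (D.indicator fun x => min (r x) M) := by
    refine ⟨(hr.min measurable_const).indicator mD, fun x => (hle x).trans (min_le_left _ _),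
      ⟨M, fun x => (hle x).trans (min_le_right _ _)⟩, fun m j => ?_⟩
    rcases le_total n m with hnm | hnm
    · exact (lintegral_mono hle).trans ((bound m j).trans (hn m hnm))
    · refine (setLIntegral_le_lintegral _ _).trans ?_
      rw [lintegral_indicator mD]
      exact (bound n i).trans ((hn n le_rfl).trans (hH hnm))
  have := hadm.le_capacity n i
  rwa [← hD, lintegral_indicator mD, Measure.restrict_restrict mD, inter_self] at this

/-- The part of the interval where the selection never stops carries finite mass of `r`. -/
lemma setLIntegral_diff_stopped_le {a L : ℝ} (hL : 0 < L) {H : ℕ → ENNReal} (hH : Antitone H)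
    (hfin : ∀ n, H n ≠ ⊤) {r : ℝ → ENNReal} (hr : Measurable r)
    (hsmall : ∀ M : NNReal, ∃ n, ∀ m ≥ n, M * ENNReal.ofReal (L / 2 ^ m) ≤ H m)
    (h0 : dyadicCapacity a L H r 0 0 < H 0) :
    ∫⁻ x in Ioc a (a + L) \ ⋃ (m) (i ∈ stopped (dyadicCapacity a L H r) H m),
      dyadic a L (m + 1) i, r x ≤ dyadicCapacity a L H r 0 0 := by
  set V := dyadicCapacity a L H r with hV
  set E := Ioc a (a + L) \ ⋃ (m) (i ∈ stopped V H m), dyadic a L (m + 1) i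
  have htrunc : ∀ M : ℕ, ∫⁻ x in E, min (r x) M ≤ V 0 0 := by
    intro M
    obtain ⟨n, hn⟩ := hsmall M
    have hn' : ∀ i, ∫⁻ x in dyadic a L n i, min (r x) (M : ENNReal) ≤ V n i := fun i => by
      simpa using setLIntegral_min_le_capacity (a := a) hH hr (M : NNReal) hn i
    calc ∫⁻ x in E, min (r x) M ≤ ∫⁻ x in liveSet a L V H n, min (r x) M :=
          lintegral_mono_set (diff_stopped_subset_liveSet hL V H n)
      _ = ∑ i ∈ live V H n, ∫⁻ x in dyadic a L n i, min (r x) M := by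
          rw [liveSet, lintegral_biUnion_finset]
          · exact fun i _ j _ hij => disjoint_dyadic hL n hij
          · exact fun i _ => measurableSet_dyadic _ _ _ _
      _ ≤ ∑ i ∈ live V H n, V n i := Finset.sum_le_sum fun i _ => hn' i
      _ ≤ V 0 0 := le_trans le_self_add
          (sum_live_add_sum_stopped_le h0 (fun n i => capacity_add_le hL hH hfin) n)
  have hsup : ∀ x, r x = ⨆ M : ℕ, min (r x) (M : ENNReal) := fun x => by
    have h := inf_iSup_eq (r x) (fun M : ℕ => (M : ENNReal))
    rw [ENNReal.iSup_natCast, inf_top_eq] at h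
    exact h
  rw [lintegral_congr hsup, lintegral_iSup (fun M => hr.min measurable_const)]
  · exact iSup_le htrunc
  · intro M M' hM x
    exact min_le_min_left _ (by exact_mod_cast hM)

lemma tsum_stopped_le {V : ℕ → ℕ → ENNReal} {H : ℕ → ENNReal} (h0 : V 0 0 < H 0)
    (hV : ∀ n i, V n i < H n → V (n + 1) (2 * i) + V (n + 1) (2 * i + 1) ≤ V n i) :
    ∑' k : ℕ × ℕ, (if k.2 ∈ stopped V H k.1 then H (k.1 + 1) else 0) ≤ V 0 0 := by
  rw [ENNReal.tsum_prod', ENNReal.tsum_eq_iSup_nat]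
  refine iSup_le fun n => le_trans (le_of_eq ?_)
    (le_trans le_add_self (sum_live_add_sum_stopped_le h0 hV n))
  refine Finset.sum_congr rfl fun m _ => ?_
  rw [tsum_eq_sum (s := stopped V H m) (fun i hi => by simp [hi])]
  exact Finset.sum_congr rfl fun i hi => by simp [hi]

lemma IsGauge.nonneg {h : ℝ → ℝ} (hh : IsGauge h) {x : ℝ} (hx : 0 ≤ x) : 0 ≤ h x :=
  hh.zero ▸ hh.mono self_mem_Ici hx hx

lemma IsGauge.pos {h : ℝ → ℝ} (hh : IsGauge h) {x : ℝ} (hx : 0 < x) : 0 < h x := by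
  obtain ⟨y, hy, hy0, hyx⟩ := ((hh.r2.eventually_gt_atTop 0).and (Ioo_mem_nhdsGT hx)).exists
  have : 0 < h y := by simpa [div_mul_cancel₀ _ hy0.ne'] using mul_pos hy hy0
  exact this.trans_le (hh.mono hy0.le hx.le hyx.le)

lemma IsGauge.two_mul_le {h : ℝ → ℝ} (hh : IsGauge h) {x : ℝ} (hx : 0 < x) :
    h (2 * x) ≤ 2 * h x := by
  have := hh.r1 hx (show x ≤ 2 * x by linarith)
  rw [div_le_div_iff₀ (by positivity) hx] at this
  nlinarith

lemma IsGauge.exists_mul_dyadic_length_le {h : ℝ → ℝ} (hh : IsGauge h) {L : ℝ} (hL : 0 < L)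
    (M : NNReal) :
    ∃ n : ℕ, ∀ m ≥ n, M * ENNReal.ofReal (L / 2 ^ m) ≤ ENNReal.ofReal (h (L / 2 ^ m) / 8) := by
  have hlim : Tendsto (fun m : ℕ => L / 2 ^ m) atTop (𝓝[>] 0) := by
    refine tendsto_nhdsWithin_iff.2 ⟨?_, Eventually.of_forall fun m => ?_⟩
    · exact tendsto_const_nhds.div_atTop (tendsto_pow_atTop_atTop_of_one_lt one_lt_two)
    · exact show 0 < L / 2 ^ m by positivity
  obtain ⟨n, hn⟩ := eventually_atTop.1 ((hh.r2.comp hlim).eventually_ge_atTop (8 * M : ℝ))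
  refine ⟨n, fun m hm => ?_⟩
  have hl : 0 < L / 2 ^ m := by positivity
  have := hn m hm
  rw [Function.comp_apply, le_div_iff₀ hl] at this
  rw [← ENNReal.ofReal_coe_nnreal, ← ENNReal.ofReal_mul M.coe_nonneg]
  exact ENNReal.ofReal_le_ofReal (by linarith)

/-- Control of an admissible function on dyadic intervals gives control on all intervals. -/
lemma Admissible.setLIntegral_Icc_le {h : ℝ → ℝ} (hh : IsGauge h) {a L : ℝ} (hL : 0 < L)
    {r g : ℝ → ENNReal} (hr : ∀ x ∉ Ioc a (a + L), r x = 0)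
    (hg : Admissible a L (fun m => ENNReal.ofReal (h (L / 2 ^ m) / 8)) r g)
    {c d : ℝ} (hcd : c ≤ d) :
    ∫⁻ x in Icc c d, g x ≤ ENNReal.ofReal (h (d - c) / 2) := by
  have hsupp : ∀ x ∉ Ioc a (a + L), g x = 0 := fun x hx => by simpa [hr x hx] using hg.le x
  rw [← setLIntegral_congr (Ioc_ae_eq_Icc (μ := volume) (a := c) (b := d))]
  rcases hcd.eq_or_lt with rfl | hlt
  · simp
  have hmono : ∀ S : Set ℝ, MeasurableSet S → Ioc c d ∩ Ioc a (a + L) ⊆ S →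
      ∫⁻ x in Ioc c d, g x ≤ ∫⁻ x in S, g x := by
    intro S hS hsub
    rw [← lintegral_indicator measurableSet_Ioc, ← lintegral_indicator hS]
    refine lintegral_mono fun x => ?_
    by_cases hx : x ∈ Ioc c d
    · by_cases hx' : x ∈ Ioc a (a + L)
      · simp [hx, hsub ⟨hx, hx'⟩]
      · simp [indicator, hsupp x hx']
    · simp [hx]
  have hpos : 0 < d - c := sub_pos.2 hlt
  rcases le_total L (d - c) with hLl | hLl
  · refine (hmono _ (measurableSet_dyadic a L 0 0) (by simp [dyadic_zero])).trans ?_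
    refine (hg.mass_le 0 0).trans (ENNReal.ofReal_le_ofReal ?_)
    have := hh.mono hL.le hpos.le hLl
    have := hh.nonneg hL.le
    simp only [pow_zero, div_one]
    linarith
  · obtain ⟨n, hn1, hn2⟩ := exists_nat_pow_near_of_lt_one (x := (d - c) / L)
      (y := (1 / 2 : ℝ)) (by positivity) ((div_le_one hL).2 hLl) (by norm_num) (by norm_num)
    set l := L / 2 ^ n with hl
    have hl0 : 0 < l := by positivity
    have hl1 : d - c ≤ l := by
      rw [div_le_iff₀ hL] at hn2
      calc d - c ≤ (1 / 2) ^ n * L := hn2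
        _ = l := by rw [hl, one_div, inv_pow]; ring
    have hl2 : l ≤ 2 * (d - c) := by
      rw [lt_div_iff₀ hL, pow_succ] at hn1
      have : (1 / 2 : ℝ) ^ n * L = l := by rw [hl, one_div, inv_pow]; ring
      nlinarith
    set j := ⌊(max c a - a) / l⌋₊
    have hj1 : j * l ≤ max c a - a := by
      rw [← le_div_iff₀ hl0]
      exact Nat.floor_le (div_nonneg (sub_nonneg.2 (le_max_right _ _)) hl0.le)
    have hj2 : max c a - a < (j + 1) * l := by
      rw [← div_lt_iff₀ hl0]
      exact Nat.lt_floor_add_one _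
    calc ∫⁻ x in Ioc c d, g x
        ≤ ∫⁻ x in dyadic a L n j ∪ dyadic a L n (j + 1), g x := by
          refine hmono _ ((measurableSet_dyadic _ _ _ _).union (measurableSet_dyadic _ _ _ _)) ?_
          rintro x ⟨⟨hx1, hx2⟩, hx3, -⟩
          have hxm : max c a < x := max_lt hx1 hx3
          have hcm := le_max_left c a
          simp only [dyadic, mem_union, mem_Ioc, ← hl]
          push_cast
          rcases le_or_gt x (a + (j + 1) * l) with hx | hx
          · exact Or.inl ⟨by linarith, hx⟩
          · exact Or.inr ⟨hx, by linarith⟩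
      _ ≤ (∫⁻ x in dyadic a L n j, g x) + ∫⁻ x in dyadic a L n (j + 1), g x :=
          lintegral_union_le _ _ _
      _ ≤ ENNReal.ofReal (h l / 8) + ENNReal.ofReal (h l / 8) :=
          add_le_add (hg.mass_le n j) (hg.mass_le n (j + 1))
      _ = ENNReal.ofReal (h l / 8 + h l / 8) := by
          have := hh.nonneg hl0.le
          rw [ENNReal.ofReal_add] <;> positivity
      _ ≤ ENNReal.ofReal (h (d - c) / 2) := by
          refine ENNReal.ofReal_le_ofReal ?_
          have h1 := hh.mono hl0.le (show 0 ≤ 2 * (d - c) by linarith) hl2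
          have h2 := hh.two_mul_le hpos
          linarith

/-- Either `r` has a bounded minorant with large mass which is controlled by `h` on every
interval, or `r` has finite mass off a disjoint family of intervals with finite `h`-sum that
does not exhaust the interval. -/
lemma IsGauge.minorant_or_intervals {h : ℝ → ℝ} (hh : IsGauge h) {a L : ℝ} (hL : 0 < L)
    {r : ℝ → ENNReal} (hr : Measurable r) (hsupp : ∀ x ∉ Ioc a (a + L), r x = 0) :
    (∃ g : ℝ → ENNReal, Measurable g ∧ (∀ x, g x ≤ r x) ∧ (∃ M : NNReal, ∀ x, g x ≤ M) ∧
      (∀ c d, c ≤ d → ∫⁻ x in Icc c d, g x ≤ ENNReal.ofReal (h (d - c) / 2)) ∧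
      ENNReal.ofReal (h L / 16) ≤ ∫⁻ x, g x) ∨
    ∃ u v : ℕ × ℕ → ℝ, (∀ k, a ≤ u k ∧ u k ≤ v k ∧ v k ≤ a + L) ∧
      Pairwise (fun k l => Disjoint (Ioc (u k) (v k)) (Ioc (u l) (v l))) ∧
      ∑' k, ENNReal.ofReal (h (v k - u k)) < ⊤ ∧
      ∑' k, ENNReal.ofReal (v k - u k) < ENNReal.ofReal L ∧
      ∫⁻ x in Ioc a (a + L) \ ⋃ k, Ioc (u k) (v k), r x < ⊤ := by
  classical
  set H : ℕ → ENNReal := fun m => ENNReal.ofReal (h (L / 2 ^ m) / 8) with hHdef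
  have hlen : ∀ m : ℕ, 0 < L / 2 ^ m := fun m => by positivity
  have hH : Antitone H := by
    intro m n hmn
    refine ENNReal.ofReal_le_ofReal (div_le_div_of_nonneg_right ?_ (by norm_num))
    refine hh.mono (hlen n).le (hlen m).le ?_
    gcongr
    norm_num
  have hfin : ∀ n, H n ≠ ⊤ := fun n => ENNReal.ofReal_ne_top
  have hLpos := hh.pos hL
  set V := dyadicCapacity a L H r with hVdef
  rcases le_or_gt (H 0) (V 0 0) with hge | hlt
  · left
    have h16 : ENNReal.ofReal (h L / 16) < V 0 0 := by
      refine lt_of_lt_of_le ?_ hge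
      simp only [hHdef, pow_zero, div_one]
      exact (ENNReal.ofReal_lt_ofReal_iff (by positivity)).2 (by linarith)
    obtain ⟨g, hg, hlt⟩ : ∃ g, ∃ _ : Admissible a L H r g,
        ENNReal.ofReal (h L / 16) < ∫⁻ x in dyadic a L 0 0, g x := by
      simpa only [hVdef, dyadicCapacity, lt_iSup_iff] using h16
    exact ⟨g, hg.measurable, hg.le, hg.bounded,
      fun c d hcd => hg.setLIntegral_Icc_le hh hL hsupp hcd,
      hlt.le.trans (setLIntegral_le_lintegral _ _)⟩
  · right
    have hV : ∀ n i, V n i < H n → V (n + 1) (2 * i) + V (n + 1) (2 * i + 1) ≤ V n i :=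
      fun n i => capacity_add_le hL hH hfin
    set P : ℕ × ℕ → Prop := fun k => k.2 ∈ stopped V H k.1 with hP
    set l : ℕ × ℕ → ℝ := fun k => L / 2 ^ (k.1 + 1) with hl
    set u : ℕ × ℕ → ℝ := fun k => if P k then a + k.2 * l k else a with hu
    set v : ℕ × ℕ → ℝ := fun k => if P k then a + (k.2 + 1) * l k else a with hv
    have huv : ∀ k, v k - u k = if P k then l k else 0 := by
      intro k
      by_cases hk : P k <;> simp [hu, hv, hk]
      ring
    have hIoc : ∀ k, Ioc (u k) (v k) = if P k then dyadic a L (k.1 + 1) k.2 else ∅ := by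
      intro k
      by_cases hk : P k <;> simp [hu, hv, hk, dyadic, hl]
    have hl0 : ∀ k, 0 < l k := fun k => hlen _
    have hsum := tsum_stopped_le hlt hV
    refine ⟨u, v, fun k => ?_, fun k k' hkk' => ?_, ?_, ?_, ?_⟩
    · by_cases hk : P k
      · have hlt' : u k < v k := by
          rw [← sub_pos, huv, if_pos hk]; exact hl0 k
        have hsub : Ioc (u k) (v k) ⊆ Ioc a (a + L) := by
          rw [hIoc, if_pos hk, ← dyadic_zero]
          have h1 := (dyadic_subset_liveSet (a := a) hL (Finset.mem_filter.1 hk).1).trans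
            (antitone_liveSet hL V H (Nat.zero_le _))
          simpa [liveSet, live] using h1
        have := (Ioc_subset_Ioc_iff hlt').1 hsub
        exact ⟨this.2, hlt'.le, this.1⟩
      · simp [hu, hv, hk, hL.le]
    · simp only [hIoc]
      by_cases hk : P k
      · by_cases hk' : P k'
        · simpa [hk, hk'] using disjoint_dyadic_stopped (a := a) hL hk hk' hkk'
        · simp [hk']
      · simp [hk]
    · calc ∑' k, ENNReal.ofReal (h (v k - u k))
          = ∑' k : ℕ × ℕ, 8 * (if k.2 ∈ stopped V H k.1 then H (k.1 + 1) else 0) := by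
            refine tsum_congr fun k => ?_
            rw [huv]
            by_cases hk : k.2 ∈ stopped V H k.1
            · rw [if_pos hk, if_pos (show P k from hk)]
              simp only [hHdef]
              rw [show (8 : ENNReal) = ENNReal.ofReal 8 by simp,
                ← ENNReal.ofReal_mul (by norm_num)]
              congr 1
              ring
            · simp [hP, hk, hh.zero]
        _ ≤ 8 * V 0 0 := by rw [ENNReal.tsum_mul_left]; gcongr
        _ < ⊤ := ENNReal.mul_lt_top (by simp) (hlt.trans ENNReal.ofReal_lt_top)
    · have hK : 0 < 8 * L / h L := by positivity
      calc ∑' k, ENNReal.ofReal (v k - u k)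
          ≤ ∑' k : ℕ × ℕ, ENNReal.ofReal (8 * L / h L) *
              (if k.2 ∈ stopped V H k.1 then H (k.1 + 1) else 0) := by
            refine ENNReal.tsum_le_tsum fun k => ?_
            rw [huv]
            by_cases hk : k.2 ∈ stopped V H k.1
            · rw [if_pos hk, if_pos (show P k from hk)]
              simp only [hHdef]
              rw [← ENNReal.ofReal_mul hK.le]
              refine ENNReal.ofReal_le_ofReal ?_
              have h1 := hh.r1 (hl0 k) (show l k ≤ L from
                div_le_self hL.le (one_le_pow₀ (by norm_num)))
              rw [div_le_div_iff₀ hL (hl0 k)] at h1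
              rw [div_mul_div_comm, le_div_iff₀ (by positivity)]
              nlinarith
            · simp [hP, hk]
        _ ≤ ENNReal.ofReal (8 * L / h L) * V 0 0 := by rw [ENNReal.tsum_mul_left]; gcongr
        _ < ENNReal.ofReal (8 * L / h L) * H 0 :=
            ENNReal.mul_lt_mul_right (ENNReal.ofReal_pos.2 hK).ne' ENNReal.ofReal_ne_top hlt
        _ = ENNReal.ofReal L := by
            simp only [hHdef, pow_zero, div_one]
            rw [← ENNReal.ofReal_mul hK.le]
            congr 1
            field_simp
    · have hE := setLIntegral_diff_stopped_le hL hH hfin hr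
        (hh.exists_mul_dyadic_length_le hL) hlt
      refine lt_of_le_of_lt (le_trans (le_of_eq ?_) hE) (hlt.trans ENNReal.ofReal_lt_top)
      congr 3
      ext x
      simp only [mem_iUnion, hIoc]
      constructor
      · rintro ⟨k, hk⟩
        by_cases hPk : P k
        · exact ⟨k.1, k.2, hPk, by simpa [hPk] using hk⟩
        · simp [hPk] at hk
      · rintro ⟨m, i, hi, hx⟩
        exact ⟨(m, i), by rwa [if_pos (show P (m, i) from hi)]⟩

section Arcs

variable {T : ℝ}

lemma AddCircle.measurable_equivIoc_coe [hT : Fact (0 < T)] (a : ℝ) :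
    Measurable fun ζ : AddCircle T => (AddCircle.equivIoc T a ζ : ℝ) :=
  measurable_subtype_coe.comp (AddCircle.measurableEquivIoc T a).measurable

lemma AddCircle.volume_image_coe [hT : Fact (0 < T)] {a : ℝ} {S : Set ℝ} (hS : MeasurableSet S)
    (hSa : S ⊆ Ioc a (a + T)) :
    volume (((↑) : ℝ → AddCircle T) '' S) = volume S := by
  have himage : ((↑) : ℝ → AddCircle T) '' S
      = (fun ζ => (AddCircle.equivIoc T a ζ : ℝ)) ⁻¹' S := by
    ext ζ
    constructor
    · rintro ⟨x, hx, rfl⟩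
      simpa [AddCircle.equivIoc_coe_of_mem (hSa hx)] using hx
    · intro hζ
      exact ⟨_, hζ, AddCircle.coe_equivIoc⟩
  rw [himage, AddCircle.add_projection_respects_measure T a
    (AddCircle.measurable_equivIoc_coe a hS)]
  congr 1
  ext x
  constructor
  · rintro ⟨hx, hxa⟩
    simpa [AddCircle.equivIoc_coe_of_mem hxa] using hx
  · intro hx
    refine ⟨?_, hSa hx⟩
    simpa [AddCircle.equivIoc_coe_of_mem (hSa hx)] using hx

lemma AddCircle.volume_singleton_coe [hT : Fact (0 < T)] (c : ℝ) :
    volume {(c : AddCircle T)} = 0 := by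
  have h := AddCircle.volume_image_coe (T := T) (a := c - T) (measurableSet_singleton c)
    (by simpa using hT.out)
  simpa using h

/-- Up to its endpoints, a nonempty connected subset of the circle is the image of an interval
of length at most the period. -/
lemma AddCircle.exists_interval_of_isPreconnected [hT : Fact (0 < T)] {Δ : Set (AddCircle T)}
    (hΔ : IsPreconnected Δ) (hne : Δ.Nonempty) :
    ∃ c d : ℝ, c ≤ d ∧ d ≤ c + T ∧ ((↑) : ℝ → AddCircle T) '' Ioo c d ⊆ Δ ∧
      Δ ⊆ ((↑) : ℝ → AddCircle T) '' Icc c d := by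
  by_cases huniv : Δ = univ
  · subst huniv
    refine ⟨0, 0 + T, by simpa using hT.out.le, le_rfl, subset_univ _, ?_⟩
    rw [AddCircle.coe_image_Icc_eq]
  obtain ⟨p, hp⟩ := (ne_univ_iff_exists_notMem _).1 huniv
  induction p using QuotientAddGroup.induction_on with | H p => ?_
  set F : AddCircle T → ℝ := fun ζ => (AddCircle.equivIco T p ζ : ℝ)
  have hF : ∀ ζ, (F ζ : AddCircle T) = ζ := fun ζ => AddCircle.coe_equivIco
  have hcont : ContinuousOn F Δ := by
    intro ζ hζ
    have hne : ζ ≠ p := by rintro rfl; exact hp hζ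
    exact (continuousAt_subtype_val.comp
      (AddCircle.continuousAt_equivIco T p hne)).continuousWithinAt
  have hord : OrdConnected (F '' Δ) := (hΔ.image F hcont).ordConnected
  have hmem : ∀ x ∈ F '' Δ, x ∈ Ico p (p + T) := by
    rintro _ ⟨ζ, _, rfl⟩
    exact (AddCircle.equivIco T p ζ).2
  have hbelow : BddBelow (F '' Δ) := ⟨p, fun x hx => (hmem x hx).1⟩
  have habove : BddAbove (F '' Δ) := ⟨p + T, fun x hx => (hmem x hx).2.le⟩
  have hneF : (F '' Δ).Nonempty := hne.image F
  have hc : p ≤ sInf (F '' Δ) := le_csInf hneF fun x hx => (hmem x hx).1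
  have hd : sSup (F '' Δ) ≤ p + T := csSup_le hneF fun x hx => (hmem x hx).2.le
  refine ⟨sInf (F '' Δ), sSup (F '' Δ), csInf_le_csSup hneF hbelow habove, by linarith,
    ?_, fun ζ hζ => ?_⟩
  · rintro _ ⟨x, ⟨hx1, hx2⟩, rfl⟩
    obtain ⟨y, hy, hyx⟩ := exists_lt_of_csInf_lt hneF hx1
    obtain ⟨z, hz, hxz⟩ := exists_lt_of_lt_csSup hneF hx2
    obtain ⟨ζ, hζ, rfl⟩ := hord.out hy hz ⟨hyx.le, hxz.le⟩
    rwa [hF]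
  · exact ⟨F ζ, ⟨csInf_le hbelow ⟨ζ, hζ, rfl⟩, le_csSup habove ⟨ζ, hζ, rfl⟩⟩, hF ζ⟩

lemma AddCircle.arc_eq_union_endpoints {Δ : Set (AddCircle T)} {c d : ℝ}
    (hsub : ((↑) : ℝ → AddCircle T) '' Ioo c d ⊆ Δ)
    (hsup : Δ ⊆ ((↑) : ℝ → AddCircle T) '' Icc c d) :
    Δ = ((↑) : ℝ → AddCircle T) '' Ioo c d ∪ Δ ∩ {(c : AddCircle T), (d : AddCircle T)} := by
  refine Subset.antisymm (fun ζ hζ => ?_) (union_subset hsub inter_subset_left)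
  obtain ⟨x, ⟨hx1, hx2⟩, rfl⟩ := hsup hζ
  rcases hx1.eq_or_lt with rfl | hx1
  · exact Or.inr ⟨hζ, by simp⟩
  rcases hx2.eq_or_lt with rfl | hx2
  · exact Or.inr ⟨hζ, by simp⟩
  exact Or.inl ⟨x, ⟨hx1, hx2⟩, rfl⟩

lemma AddCircle.isOpen_image_Ioo (c d : ℝ) : IsOpen (((↑) : ℝ → AddCircle T) '' Ioo c d) :=
  QuotientAddGroup.isOpenMap_coe _ isOpen_Ioo

lemma AddCircle.measurableSet_of_isPreconnected [hT : Fact (0 < T)] {Δ : Set (AddCircle T)}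
    (hΔ : IsPreconnected Δ) : MeasurableSet Δ := by
  rcases Δ.eq_empty_or_nonempty with rfl | hne
  · exact MeasurableSet.empty
  obtain ⟨c, d, -, -, hsub, hsup⟩ := AddCircle.exists_interval_of_isPreconnected hΔ hne
  rw [AddCircle.arc_eq_union_endpoints hsub hsup]
  exact (AddCircle.isOpen_image_Ioo c d).measurableSet.union
    ((Set.toFinite {(c : AddCircle T), (d : AddCircle T)}).inter_of_right _).measurableSet

lemma AddCircle.volume_image_Ioo [hT : Fact (0 < T)] {a c d : ℝ} (hac : a ≤ c) (hda : d ≤ a + T) :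
    volume (((↑) : ℝ → AddCircle T) '' Ioo c d) = ENNReal.ofReal (d - c) := by
  rw [AddCircle.volume_image_coe (a := a) measurableSet_Ioo, Real.volume_Ioo]
  exact fun x hx => ⟨hac.trans_lt hx.1, hx.2.le.trans hda⟩

lemma AddCircle.volume_arc [hT : Fact (0 < T)] {Δ : Set (AddCircle T)} {c d : ℝ} (hd : d ≤ c + T)
    (hsub : ((↑) : ℝ → AddCircle T) '' Ioo c d ⊆ Δ)
    (hsup : Δ ⊆ ((↑) : ℝ → AddCircle T) '' Icc c d) :
    volume Δ = ENNReal.ofReal (d - c) := by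
  rw [← AddCircle.volume_image_Ioo le_rfl hd]
  refine le_antisymm ?_ (measure_mono hsub)
  rw [AddCircle.arc_eq_union_endpoints hsub hsup]
  refine (measure_union_le _ _).trans ?_
  have hzero : volume (Δ ∩ {(c : AddCircle T), (d : AddCircle T)}) = 0 := by
    refine measure_mono_null inter_subset_right ?_
    rw [← singleton_union]
    exact measure_union_null (AddCircle.volume_singleton_coe c) (AddCircle.volume_singleton_coe d)
  rw [hzero, add_zero]

/-- In a fundamental interval, an arc lifts into the union of two translates of an interval
no longer than the arc. -/
lemma AddCircle.exists_Icc_cover [hT : Fact (0 < T)] (a : ℝ) {Δ : Set (AddCircle T)}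
    (hΔ : IsPreconnected Δ) :
    ∃ c d : ℝ, c ≤ d ∧ d - c ≤ (volume Δ).toReal ∧
      ∀ x ∈ Ioc a (a + T), (x : AddCircle T) ∈ Δ → x ∈ Icc c d ∪ Icc (c - T) (d - T) := by
  rcases Δ.eq_empty_or_nonempty with rfl | hne
  · exact ⟨0, 0, le_rfl, by simp, by simp⟩
  obtain ⟨c, d, hcd, hd, hsub, hsup⟩ := AddCircle.exists_interval_of_isPreconnected hΔ hne
  obtain ⟨k, ⟨hk1, hk2⟩, -⟩ := existsUnique_add_zsmul_mem_Ioc hT.out c a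
  have hTpos := hT.out
  refine ⟨c + k • T, d + k • T, by linarith, ?_, fun x hx hxΔ => ?_⟩
  · rw [AddCircle.volume_arc hd hsub hsup, ENNReal.toReal_ofReal (by linarith)]
    linarith
  · obtain ⟨y, ⟨hy1, hy2⟩, hyx⟩ := hsup hxΔ
    obtain ⟨n, hn⟩ := AddSubgroup.mem_zmultiples_iff.1
      (QuotientAddGroup.eq.1 hyx)
    obtain ⟨hx1, hx2⟩ := hx
    obtain ⟨n', rfl⟩ : ∃ n', n = n' + k := ⟨n - k, by ring⟩
    rw [add_zsmul] at hn
    have hxy : x = y + k • T + n' • T := by linarith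
    rw [zsmul_eq_mul T n'] at hxy
    have hn1 : n' < 1 := by
      have : (n' : ℝ) < 1 := by
        by_contra hcon
        nlinarith [not_lt.1 hcon]
      exact_mod_cast this
    have hn2 : -2 < n' := by
      have : (-2 : ℝ) < n' := by
        by_contra hcon
        nlinarith [not_lt.1 hcon]
      exact_mod_cast this
    obtain rfl | rfl : n' = 0 ∨ n' = -1 := by omega
    · left; constructor <;> push_cast at hxy <;> linarith
    · right; constructor <;> push_cast at hxy <;> linarith

end Arcs

lemma measurable_nlog : Measurable nlog :=
  Measurable.ite (measurableSet_singleton 0) measurable_const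
    (ENNReal.measurable_ofReal.comp (Real.measurable_log.comp measurable_inv))

lemma isHCarleson_compl_iUnion {ι : Type*} [Denumerable ι] {h : ℝ → ℝ} {O : ι → Set UnitCircle}
    (hopen : ∀ j, IsOpen (O j)) (hconn : ∀ j, IsPreconnected (O j))
    (hdisj : Pairwise fun j k => Disjoint (O j) (O k))
    (hsum : ∑' j, ENNReal.ofReal (h (volume (O j)).toReal) < ⊤) :
    IsHCarleson h (⋃ j, O j)ᶜ := by
  let e : ℕ ≃ ι := (Denumerable.eqv ι).symm
  refine ⟨(isOpen_iUnion hopen).isClosed_compl, fun n => O (e n),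
    fun n => ⟨hopen _, hconn _⟩, fun k l hkl => hdisj (e.injective.ne hkl), ?_, ?_⟩
  · rw [compl_compl]
    exact e.surjective.iUnion_comp O
  · rwa [e.tsum_eq (fun j => ENNReal.ofReal (h (volume (O j)).toReal))]

/-- Removing from the circle the images of countably many disjoint intervals with finite `h`-sum
which do not exhaust the period leaves an `h`-Carleson set of positive measure. -/
lemma isHCarleson_compl_iUnion_image {ι : Type*} [Denumerable ι] {h : ℝ → ℝ} {a : ℝ}
    {s t : ι → ℝ} (hs : ∀ j, a ≤ s j) (hst : ∀ j, s j ≤ t j) (ht : ∀ j, t j ≤ a + 2 * Real.pi)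
    (hdisj : Pairwise fun j k => Disjoint (Ioo (s j) (t j)) (Ioo (s k) (t k)))
    (hsum : ∑' j, ENNReal.ofReal (h (t j - s j)) < ⊤)
    (hlen : ∑' j, ENNReal.ofReal (t j - s j) < ENNReal.ofReal (2 * Real.pi)) :
    IsHCarleson h (⋃ j, ((↑) : ℝ → UnitCircle) '' Ioo (s j) (t j))ᶜ ∧
      0 < volume (⋃ j, ((↑) : ℝ → UnitCircle) '' Ioo (s j) (t j))ᶜ := by
  have hvol : ∀ j, volume (((↑) : ℝ → UnitCircle) '' Ioo (s j) (t j))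
      = ENNReal.ofReal (t j - s j) := fun j => AddCircle.volume_image_Ioo (hs j) (ht j)
  have hopen : ∀ j, IsOpen (((↑) : ℝ → UnitCircle) '' Ioo (s j) (t j)) :=
    fun j => AddCircle.isOpen_image_Ioo _ _
  have hmem : ∀ j, Ioo (s j) (t j) ⊆ Ioc a (a + 2 * Real.pi) :=
    fun j x hx => ⟨(hs j).trans_lt hx.1, hx.2.le.trans (ht j)⟩
  refine ⟨isHCarleson_compl_iUnion hopen (fun j => ?_) (fun j k hjk => ?_) ?_, ?_⟩
  · exact isPreconnected_Ioo.image _ (AddCircle.continuous_mk' _).continuousOn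
  · refine Set.disjoint_left.2 ?_
    rintro _ ⟨x, hx, rfl⟩ ⟨y, hy, hyx⟩
    rw [AddCircle.coe_eq_coe_iff_of_mem_Ioc (hmem k hy) (hmem j hx)] at hyx
    subst hyx
    exact Set.disjoint_left.1 (hdisj hjk) hx hy
  · simp_rw [hvol]
    convert hsum using 4 with j
    rw [ENNReal.toReal_ofReal (sub_nonneg.2 (hst j))]
  · rw [measure_compl (isOpen_iUnion hopen).measurableSet (measure_ne_top _ _),
      AddCircle.measure_univ, tsub_pos_iff_lt]
    refine lt_of_le_of_lt (measure_iUnion_le _) ?_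
    simp_rw [hvol]
    exact hlen

/-- A function on the circle which is bounded by `N + r` on an arc, with `r` integrable off a
family of intervals in the arc, is integrable on an `h`-Carleson set of positive measure. -/
lemma exists_isHCarleson_lintegral_lt_top {h : ℝ → ℝ} {a L : ℝ} (hL : 0 < L)
    (hLT : L ≤ 2 * Real.pi) {R : UnitCircle → ENNReal} {r : ℝ → ENNReal}
    {N : NNReal} (hRr : ∀ x ∈ Ioo a (a + L), R x ≤ N + r x) {u v : ℕ × ℕ → ℝ}
    (huv : ∀ k, a ≤ u k ∧ u k ≤ v k ∧ v k ≤ a + L)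
    (hdisj : Pairwise fun k l => Disjoint (Ioc (u k) (v k)) (Ioc (u l) (v l)))
    (hsum : ∑' k, ENNReal.ofReal (h (v k - u k)) < ⊤)
    (hlen : ∑' k, ENNReal.ofReal (v k - u k) < ENNReal.ofReal L)
    (hbound : ∫⁻ x in Ioc a (a + L) \ ⋃ k, Ioc (u k) (v k), r x < ⊤) :
    ∃ E : Set UnitCircle, IsHCarleson h E ∧ 0 < volume E ∧ ∫⁻ ζ in E, R ζ < ⊤ := by
  set s : Option (ℕ × ℕ) → ℝ := fun j => j.elim (a + L) u with hs
  set t : Option (ℕ × ℕ) → ℝ := fun j => j.elim (a + 2 * Real.pi) v with ht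
  have hsplit : ∀ F : Option (ℕ × ℕ) → ENNReal, ∑' j, F j = F none + ∑' k, F (some k) := by
    intro F
    rw [← (Equiv.optionEquivSumPUnit.{0} (ℕ × ℕ)).symm.tsum_eq,
      Summable.tsum_sum ENNReal.summable ENNReal.summable, add_comm]
    simp
  have hnone : ∀ k, Disjoint (Ioo (a + L) (a + 2 * Real.pi)) (Ioo (u k) (v k)) := fun k => by
    refine Set.disjoint_left.2 ?_
    exact fun x hx hx' => absurd (hx'.2.trans_le (huv k).2.2) hx.1.not_gt
  obtain ⟨hC, hpos⟩ := isHCarleson_compl_iUnion_image (h := h) (a := a) (s := s) (t := t)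
    (by rintro (_ | k); exacts [by simp [hs, hL.le], (huv k).1])
    (by rintro (_ | k); exacts [by simpa [hs, ht] using hLT, (huv k).2.1])
    (by
      rintro (_ | k)
      · exact le_rfl
      · exact (huv k).2.2.trans (by linarith))
    (by
      rintro (_ | k) (_ | l) hkl
      · exact absurd rfl hkl
      · exact hnone l
      · exact (hnone k).symm
      · exact (hdisj (by simpa using hkl)).mono Ioo_subset_Ioc_self Ioo_subset_Ioc_self)
    (by
      rw [hsplit]
      exact ENNReal.add_lt_top.2 ⟨ENNReal.ofReal_lt_top, hsum⟩)
    (by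
      rw [hsplit]
      calc _ < ENNReal.ofReal (2 * Real.pi - L) + ENNReal.ofReal L := by
            refine ENNReal.add_lt_add_of_le_of_lt ENNReal.ofReal_ne_top (le_of_eq ?_) hlen
            simp [hs, ht]
        _ = ENNReal.ofReal (2 * Real.pi) := by
            rw [← ENNReal.ofReal_add (by linarith) hL.le]
            congr 1
            ring)
  refine ⟨_, hC, hpos, ?_⟩
  set E := (⋃ j, ((↑) : ℝ → UnitCircle) '' Ioo (s j) (t j))ᶜ
  set F := Ioc a (a + L) \ ⋃ k, Ioc (u k) (v k)
  have mF : MeasurableSet F :=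
    measurableSet_Ioc.diff (MeasurableSet.iUnion fun k => measurableSet_Ioc)
  have hK : (({a + L, a + 2 * Real.pi} : Set ℝ) ∪ range v).Countable :=
    (Set.toFinite _).countable.union (countable_range v)
  rw [← lintegral_indicator hC.1.measurableSet, ← AddCircle.lintegral_preimage _ a]
  calc ∫⁻ x in Ioc a (a + 2 * Real.pi), E.indicator R (x : UnitCircle)
      ≤ ∫⁻ x in Ioc a (a + 2 * Real.pi), ((N : ENNReal) + F.indicator r x) := by
        refine lintegral_mono_ae ((ae_restrict_iff' measurableSet_Ioc).2 ?_)
        filter_upwards [hK.ae_notMem volume] with x hxK hx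
        simp only [mem_union, mem_insert_iff, mem_singleton_iff, mem_range, not_or,
          not_exists] at hxK
        obtain ⟨⟨hx1, hx2⟩, hx3⟩ := hxK
        by_cases hxE : (x : UnitCircle) ∈ E
        · have hxO : ∀ j, x ∉ Ioo (s j) (t j) := fun j hj =>
            hxE (mem_iUnion.2 ⟨j, x, hj, rfl⟩)
          have hxL : x < a + L := by
            by_contra hcon
            exact hxO none ⟨lt_of_le_of_ne (not_lt.1 hcon) (Ne.symm hx1),
              lt_of_le_of_ne hx.2 hx2⟩
          have hxF : x ∈ F := by
            refine ⟨⟨hx.1, hxL.le⟩, fun hcon => ?_⟩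
            obtain ⟨k, hk1, hk2⟩ := mem_iUnion.1 hcon
            exact hxO (some k) ⟨hk1, lt_of_le_of_ne hk2 (Ne.symm (hx3 k))⟩
          rw [indicator_of_mem hxE, indicator_of_mem hxF]
          exact hRr x ⟨hx.1, hxL⟩
        · simp [hxE]
    _ = N * ENNReal.ofReal (2 * Real.pi) +
          ∫⁻ x in Ioc a (a + 2 * Real.pi), F.indicator r x := by
        rw [lintegral_add_left measurable_const, setLIntegral_const, Real.volume_Ioc,
          add_sub_cancel_left]
    _ ≤ N * ENNReal.ofReal (2 * Real.pi) + ∫⁻ x in F, r x := by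
        refine add_le_add le_rfl ?_
        rw [← lintegral_indicator mF]
        exact setLIntegral_le_lintegral _ _
    _ < ⊤ := ENNReal.add_lt_top.2
        ⟨ENNReal.mul_lt_top ENNReal.coe_lt_top ENNReal.ofReal_lt_top, hbound⟩

/-- A minorant on the line controlled by `h` on intervals descends to a function on the circle
controlled by `h` on arcs. -/
lemma exists_circle_minorant {h : ℝ → ℝ} (hh : IsGauge h) {a L : ℝ}
    (hLT : L ≤ 2 * Real.pi) {g : ℝ → ENNReal} (mg : Measurable g) {M : NNReal}
    (hM : ∀ x, g x ≤ M) (hsupp : ∀ x ∉ Ioc a (a + L), g x = 0)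
    (hbound : ∀ c d, c ≤ d → ∫⁻ x in Icc c d, g x ≤ ENNReal.ofReal (h (d - c) / 2)) :
    ∃ G : UnitCircle → ℝ, Measurable G ∧ (∀ ζ, 0 ≤ G ζ) ∧ (∀ ζ, G ζ ≤ M) ∧
      (∀ ζ, ∃ x : ℝ, (x : UnitCircle) = ζ ∧ ENNReal.ofReal (G ζ) = g x) ∧
      (∀ Δ, IsArc Δ → ∫ ζ in Δ, G ζ ≤ h (volume Δ).toReal) ∧
      ENNReal.ofReal (∫ ζ, G ζ) = ∫⁻ x, g x := by
  have hfin : ∀ x, g x ≠ ⊤ := fun x => ((hM x).trans_lt ENNReal.coe_lt_top).ne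
  set G : UnitCircle → ℝ := fun ζ => (g (AddCircle.equivIoc (2 * Real.pi) a ζ)).toReal with hG
  have mG : Measurable G := (mg.comp (AddCircle.measurable_equivIoc_coe a)).ennreal_toReal
  have hG0 : ∀ ζ, 0 ≤ G ζ := fun ζ => ENNReal.toReal_nonneg
  have hGM : ∀ ζ, G ζ ≤ M := fun ζ => by
    simpa using ENNReal.toReal_mono ENNReal.coe_ne_top (hM (AddCircle.equivIoc (2 * Real.pi) a ζ))
  have hofReal : ∀ ζ, ENNReal.ofReal (G ζ) = g (AddCircle.equivIoc (2 * Real.pi) a ζ) :=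
    fun ζ => ENNReal.ofReal_toReal (hfin _)
  have hcoe : ∀ x ∈ Ioc a (a + 2 * Real.pi), ENNReal.ofReal (G (x : UnitCircle)) = g x :=
    fun x hx => by rw [hofReal, AddCircle.equivIoc_coe_of_mem hx]
  have hGi : Integrable G volume :=
    Integrable.of_bound mG.aestronglyMeasurable M (Eventually.of_forall fun ζ => by
      rw [Real.norm_of_nonneg (hG0 ζ)]; exact hGM ζ)
  refine ⟨G, mG, hG0, hGM, fun ζ => ⟨_, AddCircle.coe_equivIoc, hofReal ζ⟩, fun Δ hΔ => ?_, ?_⟩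
  · obtain ⟨c, d, hcd, hlen, hcover⟩ := AddCircle.exists_Icc_cover (T := 2 * Real.pi) a hΔ
    have mΔ : MeasurableSet Δ := AddCircle.measurableSet_of_isPreconnected hΔ
    have hhcd := hh.nonneg (sub_nonneg.2 hcd)
    refine le_trans ?_ (hh.mono (sub_nonneg.2 hcd) ENNReal.toReal_nonneg hlen)
    rw [← ENNReal.ofReal_le_ofReal_iff hhcd,
      ofReal_integral_eq_lintegral_ofReal hGi.integrableOn (Eventually.of_forall hG0),
      ← lintegral_indicator mΔ, ← AddCircle.lintegral_preimage _ a]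
    have mU : MeasurableSet (Icc c d ∪ Icc (c - 2 * Real.pi) (d - 2 * Real.pi)) :=
      measurableSet_Icc.union measurableSet_Icc
    calc ∫⁻ x in Ioc a (a + 2 * Real.pi),
          Δ.indicator (fun ζ => ENNReal.ofReal (G ζ)) (x : UnitCircle)
        ≤ ∫⁻ x in Ioc a (a + 2 * Real.pi),
            (Icc c d ∪ Icc (c - 2 * Real.pi) (d - 2 * Real.pi)).indicator g x := by
          refine setLIntegral_mono (mg.indicator mU) fun x hx => ?_
          by_cases hxΔ : (x : UnitCircle) ∈ Δ
          · rw [indicator_of_mem hxΔ, indicator_of_mem (hcover x hx hxΔ), hcoe x hx]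
          · simp [hxΔ]
      _ ≤ ∫⁻ x in Icc c d ∪ Icc (c - 2 * Real.pi) (d - 2 * Real.pi), g x := by
          rw [← lintegral_indicator mU]
          exact setLIntegral_le_lintegral _ _
      _ ≤ (∫⁻ x in Icc c d, g x) + ∫⁻ x in Icc (c - 2 * Real.pi) (d - 2 * Real.pi), g x :=
          lintegral_union_le _ _ _
      _ ≤ ENNReal.ofReal (h (d - c) / 2) + ENNReal.ofReal (h (d - c) / 2) := by
          refine add_le_add (hbound _ _ hcd) ((hbound _ _ (by linarith)).trans_eq ?_)
          rw [sub_sub_sub_cancel_right]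
      _ = ENNReal.ofReal (h (d - c)) := by
          rw [← ENNReal.ofReal_add (by positivity) (by positivity), add_halves]
  · rw [ofReal_integral_eq_lintegral_ofReal hGi (Eventually.of_forall hG0),
      ← AddCircle.lintegral_preimage _ a, setLIntegral_congr_fun measurableSet_Ioc hcoe,
      ← lintegral_indicator measurableSet_Ioc]
    refine lintegral_congr fun x => ?_
    by_cases hx : x ∈ Ioc a (a + 2 * Real.pi)
    · simp [hx]
    · rw [indicator_of_notMem hx, hsupp x fun hx' => hx ⟨hx'.1, hx'.2.trans (by linarith)⟩]

/-- duality building block. If `∫_E log w = -∞` over every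
`h`-Carleson set of positive measure, then for every `N` and arc `I` with
`|A_N ∩ I| > 0` there is a bounded function `f_{N,I}` supported on `I` satisfying
(i)–(iv), with a numerical constant `C₀ > 0` independent of all the data. -/
theorem duality_building_block :
    ∃ C₀ : ℝ, 0 < C₀ ∧
      ∀ (h : ℝ → ℝ), IsGauge h →
      ∀ (w : UnitCircle → ℝ), (∀ ζ, 0 ≤ w ζ) → Integrable w volume →
      (∀ E : Set UnitCircle, IsHCarleson h E → 0 < volume E →
        ∫⁻ ζ in E, nlog (w ζ) = ⊤) →
      ∀ (N : ℕ), 0 < N →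
      ∀ I : Set UnitCircle, IsArc I →
        0 < volume ({ζ | nlog (w ζ) ≤ (N : ENNReal)} ∩ I) →
        ∃ f : UnitCircle → ℝ, Measurable f ∧ (∃ M : ℝ, ∀ ζ, |f ζ| ≤ M) ∧
          (∀ ζ, ζ ∉ I → f ζ = 0) ∧
          (∀ᵐ ζ ∂volume, ENNReal.ofReal (f ζ) ≤ nlog (w ζ)) ∧
          (∀ Δ : Set UnitCircle, IsArc Δ →
            (∫ ζ in Δ, f ζ) ≤ h (volume Δ).toReal) ∧
          (∫ ζ in I, f ζ) = 0 ∧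
          (∀ ζ ∈ {ζ | nlog (w ζ) ≤ (N : ENNReal)} ∩ I,
            f ζ ≤ -(C₀ * h (volume I).toReal / (volume I).toReal)) := by
  refine ⟨1 / 16, by norm_num, ?_⟩
  intro h hh w _ hwi hdiv N _ I hI hpos
  have hne : I.Nonempty := (nonempty_of_measure_ne_zero hpos.ne').mono inter_subset_right
  have mI : MeasurableSet I := AddCircle.measurableSet_of_isPreconnected hI
  obtain ⟨a, b, -, hbT, hsub, hsup⟩ := AddCircle.exists_interval_of_isPreconnected hI hne
  have hvol := AddCircle.volume_arc hbT hsub hsup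
  obtain ⟨L, rfl⟩ : ∃ L, b = a + L := ⟨b - a, by ring⟩
  rw [add_sub_cancel_left] at hvol
  have hL : 0 < L :=
    ENNReal.ofReal_pos.1 (hvol ▸ hpos.trans_le (measure_mono inter_subset_right))
  have hLT : L ≤ 2 * Real.pi := by linarith
  have hvolL : (volume I).toReal = L := by rw [hvol, ENNReal.toReal_ofReal hL.le]
  -- The weight is replaced by a measurable representative, equal to it off the null set `Z`.
  set w' := hwi.1.mk w
  have mR : Measurable fun ζ => nlog (w' ζ) :=
    measurable_nlog.comp hwi.1.stronglyMeasurable_mk.measurable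
  have hae : w =ᵐ[volume] w' := hwi.1.ae_eq_mk
  set Z := toMeasurable volume {ζ | w ζ ≠ w' ζ}
  have mZ : MeasurableSet Z := measurableSet_toMeasurable _ _
  have hZ : volume Z = 0 := by rw [measure_toMeasurable]; exact hae
  have hwZ : ∀ ζ ∉ Z, w ζ = w' ζ := fun ζ hζ => by
    by_contra hcon
    exact hζ (subset_toMeasurable _ _ hcon)
  set q : UnitCircle → ENNReal := {ζ | (N : ENNReal) < nlog (w' ζ)}.indicator fun ζ => nlog (w' ζ)
    with hq
  have mq : Measurable q := mR.indicator (measurableSet_lt measurable_const mR)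
  have hqR : ∀ ζ, q ζ ≤ nlog (w' ζ) := fun ζ => indicator_le_self _ _ ζ
  set r : ℝ → ENNReal := (Ioo a (a + L)).indicator fun x => q (x : UnitCircle) with hr
  have mr : Measurable r := (mq.comp AddCircle.measurable_mk').indicator measurableSet_Ioo
  have hrq : ∀ x, r x ≤ q (x : UnitCircle) := fun x => indicator_le_self _ _ x
  have hrsupp : ∀ x ∉ Ioc a (a + L), r x = 0 := fun x hx =>
    indicator_of_notMem (fun hx' => hx (Ioo_subset_Ioc_self hx')) _
  rcases hh.minorant_or_intervals hL mr hrsupp with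
    ⟨g, mg, hgr, ⟨M, hM⟩, hgint, hgmass⟩ | ⟨u, v, huv, hdisj, hsum, hlen, hbound⟩
  · obtain ⟨G, mG, hG0, hGM, hGg, hGarc, hGtot⟩ := exists_circle_minorant hh hLT mg hM
      (fun x hx => le_zero_iff.1 ((hgr x).trans_eq (hrsupp x hx))) hgint
    have hGq : ∀ ζ, ENNReal.ofReal (G ζ) ≤ q ζ := fun ζ => by
      obtain ⟨x, rfl, hx⟩ := hGg ζ
      exact hx ▸ (hgr x).trans (hrq x)
    have hGI : ∀ ζ, ζ ∉ I → G ζ = 0 := fun ζ hζ => by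
      obtain ⟨x, rfl, hx⟩ := hGg ζ
      have hxI : x ∉ Ioo a (a + L) := fun hx' => hζ (hsub ⟨x, hx', rfl⟩)
      have hrx : r x = 0 := indicator_of_notMem hxI _
      have : ENNReal.ofReal (G x) ≤ 0 := hx ▸ (hgr x).trans_eq hrx
      exact le_antisymm (ENNReal.ofReal_eq_zero.1 (le_zero_iff.1 this)) (hG0 _)
    have hGi : Integrable G volume :=
      Integrable.of_bound mG.aestronglyMeasurable M (Eventually.of_forall fun ζ => by
        rw [Real.norm_of_nonneg (hG0 ζ)]; exact hGM ζ)
    have hmass : h L / 16 ≤ ∫ ζ, G ζ := by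
      rwa [← ENNReal.ofReal_le_ofReal_iff (integral_nonneg hG0), hGtot]
    set m := (∫ ζ, G ζ) / L with hm
    have hm0 : 0 ≤ m := div_nonneg (integral_nonneg hG0) hL.le
    have hZG : ∀ ζ, Zᶜ.indicator G ζ ≤ G ζ := fun ζ => indicator_le_self' (fun _ _ => hG0 _) ζ
    have hZG0 : ∀ ζ, 0 ≤ Zᶜ.indicator G ζ := fun ζ => indicator_nonneg (fun _ _ => hG0 _) ζ
    set f : UnitCircle → ℝ := I.indicator fun ζ => Zᶜ.indicator G ζ - m with hf
    have mf : Measurable f := ((mG.indicator mZ.compl).sub_const m).indicator mI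
    have hfG : ∀ ζ, f ζ ≤ Zᶜ.indicator G ζ := fun ζ => by
      by_cases hζ : ζ ∈ I
      · simpa [hf, hζ] using hm0
      · simpa [hf, hζ] using hZG0 ζ
    have hfb : ∀ ζ, |f ζ| ≤ M + m := fun ζ => by
      have h1 := (hfG ζ).trans ((hZG ζ).trans (hGM ζ))
      refine abs_le.2 ⟨?_, by linarith⟩
      have hM0 := M.coe_nonneg
      have h2 := hZG0 ζ
      by_cases hζ : ζ ∈ I
      · rw [hf, indicator_of_mem hζ]; linarith
      · rw [hf, indicator_of_notMem hζ]; linarith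
    have hfi : Integrable f volume :=
      Integrable.of_bound mf.aestronglyMeasurable (M + m) (Eventually.of_forall hfb)
    refine ⟨f, mf, ⟨_, hfb⟩, fun ζ hζ => indicator_of_notMem hζ _, ?_, fun Δ hΔ => ?_, ?_, ?_⟩
    · filter_upwards [hae] with ζ hζ
      rw [hζ]
      exact (ENNReal.ofReal_le_ofReal ((hfG ζ).trans (hZG ζ))).trans ((hGq ζ).trans (hqR ζ))
    · refine le_trans ?_ (hGarc Δ hΔ)
      exact integral_mono hfi.integrableOn hGi.integrableOn fun ζ => (hfG ζ).trans (hZG ζ)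
    · have hfae : ∀ᵐ ζ ∂volume.restrict I, f ζ = G ζ - m := by
        refine (ae_restrict_iff' mI).2 ?_
        filter_upwards [measure_eq_zero_iff_ae_notMem.1 hZ] with ζ hζ hζI
        simp [hf, hζI, hζ]
      rw [integral_congr_ae hfae, integral_sub hGi.integrableOn (integrable_const m),
        setIntegral_eq_integral_of_forall_compl_eq_zero hGI, setIntegral_const, measureReal_def,
        hvolL, smul_eq_mul, hm, mul_div_cancel₀ _ hL.ne', sub_self]
    · rintro ζ ⟨hζN, hζI⟩
      have hzero : Zᶜ.indicator G ζ = 0 := by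
        by_cases hζZ : ζ ∈ Z
        · simp [hζZ]
        · have hqζ : q ζ = 0 := indicator_of_notMem
            (by rw [mem_ofPred_eq, ← hwZ ζ hζZ]; exact not_lt.2 hζN) _
          have : ENNReal.ofReal (G ζ) ≤ 0 := (hGq ζ).trans_eq hqζ
          rw [indicator_of_mem (by exact hζZ)]
          exact le_antisymm (ENNReal.ofReal_eq_zero.1 (le_zero_iff.1 this)) (hG0 _)
      rw [hf, indicator_of_mem hζI, hzero, zero_sub, hvolL, hm]
      refine neg_le_neg (div_le_div_of_nonneg_right ?_ hL.le)
      linarith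
  · obtain ⟨E, hE, hEpos, hElt⟩ := exists_isHCarleson_lintegral_lt_top (h := h) hL hLT
      (R := fun ζ => nlog (w' ζ)) (N := (N : NNReal))
      (fun x hx => by
        rw [hr, indicator_of_mem hx]
        by_cases hx' : (N : ENNReal) < nlog (w' x)
        · rw [hq, indicator_of_mem (by exact hx')]
          exact le_add_self
        · exact le_add_right (by simpa using hx'))
      huv hdisj hsum hlen hbound
    refine absurd (hdiv E hE hEpos) (ne_of_lt ?_)
    refine lt_of_le_of_lt (le_of_eq (lintegral_congr_ae (ae_restrict_of_ae ?_))) hElt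
    filter_upwards [hae] with ζ hζ
    rw [hζ]
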